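/- Let F_q be a finite field of odd characteristic, let n ≥ 18, let 0 < δ ≤ 1, let P ∈ F_q[x_0, …, x_{n−1}] have degree at most 2, let χ be a nontrivial additive character of F_q, and set Φ(f) = χ(P(x(f))) for f of degree < n. Suppose |∑_{f ∈ F_q[t], deg f < n} μ(f) Φ(f)| ≥ δ q^n. Then at least one of the following holds: (1) there is an integer k with 0 ≤ 9k ≤ n such that (1/q^k) ∑_{d monic, deg d = k} |(1/q^{n−k}) ∑_{w, deg w < n−k} Φ(dw)|² ≥ δ²/(16 n⁵); or (2) there is an integer k with n ≤ 18k and 18k ≤ 17n such that (1/q^{2(n−k)}) ∑_{w, w' of degree < n−k} |(1/q^k) ∑_{d monic, deg d = k} Φ(dw) · conj(Φ(dw'))|² ≥ δ⁴/(256 n^{10}). -/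

import Mathlib

open Polynomial

/- The Möbius function on `F_q[t]`. -/
open scoped Classical in
noncomputable def polyMu {F : Type*} [Field F] (f : Polynomial F) : ℤ :=
  if Squarefree f then (-1) ^ (UniqueFactorizationMonoid.normalizedFactors f).card else 0

/-- The polynomial of degree `< n` with coefficient vector `x ∈ F_q^n`. -/
noncomputable def lowPoly (F : Type*) [Field F] (n : ℕ) (x : Fin n → F) : Polynomial F :=
  ∑ i : Fin n, C (x i) * X ^ (i : ℕ)

/-- The monic polynomial of degree `k` whose lower coefficient vector is `x ∈ F_q^k`. -/
noncomputable def monicPoly (F : Type*) [Field F] (k : ℕ) (x : Fin k → F) : Polynomial F :=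
  X ^ k + ∑ i : Fin k, C (x i) * X ^ (i : ℕ)

section Enumeration

variable {F : Type*} [Field F]

lemma lowPoly_coeff (n : ℕ) (x : Fin n → F) (j : ℕ) :
    (lowPoly F n x).coeff j = if h : j < n then x ⟨j, h⟩ else 0 := by
  simp only [lowPoly, finsetSum_coeff, coeff_C_mul_X_pow]
  split_ifs with h
  · rw [Finset.sum_eq_single ⟨j, h⟩]
    · simp
    · intro b _ hb
      rw [if_neg]
      rintro rfl
      exact hb rfl
    · simp
  · refine Finset.sum_eq_zero fun i _ => if_neg ?_
    rintro rfl
    exact h i.2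

lemma degree_lowPoly_lt (n : ℕ) (x : Fin n → F) : (lowPoly F n x).degree < n := by
  rw [degree_lt_iff_coeff_zero]
  intro m hm
  rw [lowPoly_coeff, dif_neg (by omega)]

lemma lowPoly_coeff_eq_self {n : ℕ} {f : F[X]} (hf : f.degree < n) :
    lowPoly F n (fun i => f.coeff i) = f := by
  ext j
  rw [lowPoly_coeff]
  split_ifs with h
  · rfl
  · exact ((degree_lt_iff_coeff_zero f n).1 hf j (by omega)).symm

lemma lowPoly_injective (n : ℕ) : Function.Injective (lowPoly F n) := by
  intro x y h
  funext i
  have := congrArg (fun f => coeff f i) h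
  simpa [lowPoly_coeff] using this

lemma monicPoly_injective (k : ℕ) : Function.Injective (monicPoly F k) := by
  intro x y h
  exact lowPoly_injective k (add_left_cancel h)

variable [Fintype F]

open scoped Classical in
/-- The polynomials of degree `< n`. -/
noncomputable def lowPolys (F : Type*) [Field F] [Fintype F] (n : ℕ) : Finset F[X] :=
  Finset.univ.image (lowPoly F n)

open scoped Classical in
/-- The monic polynomials of degree `k`. -/
noncomputable def monicPolys (F : Type*) [Field F] [Fintype F] (k : ℕ) : Finset F[X] :=
  Finset.univ.image (monicPoly F k)

lemma mem_lowPolys {n : ℕ} {f : F[X]} : f ∈ lowPolys F n ↔ f.degree < n := by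
  simp only [lowPolys, Finset.mem_image, Finset.mem_univ, true_and]
  constructor
  · rintro ⟨x, rfl⟩
    exact degree_lowPoly_lt n x
  · intro h
    exact ⟨_, lowPoly_coeff_eq_self h⟩

lemma mem_lowPolys_iff_natDegree {n : ℕ} {f : F[X]} (hf : f ≠ 0) :
    f ∈ lowPolys F n ↔ f.natDegree < n := by
  rw [mem_lowPolys, natDegree_lt_iff_degree_lt hf]

lemma mem_monicPolys {k : ℕ} {f : F[X]} :
    f ∈ monicPolys F k ↔ f.Monic ∧ f.natDegree = k := by
  simp only [monicPolys, Finset.mem_image, Finset.mem_univ, true_and]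
  constructor
  · rintro ⟨x, rfl⟩
    have hx := degree_lowPoly_lt k x
    exact ⟨monic_X_pow_add hx, natDegree_eq_of_degree_eq_some
      (by rw [monicPoly, degree_add_eq_left_of_degree_lt (by rw [degree_X_pow]; exact hx),
        degree_X_pow])⟩
  · rintro ⟨hm, rfl⟩
    refine ⟨fun i => (f - X ^ f.natDegree).coeff i, ?_⟩
    have hd : (f - X ^ f.natDegree).degree < (f.natDegree : WithBot ℕ) := by
      rw [← degree_eq_natDegree hm.ne_zero]
      refine degree_sub_lt_left ?_ hm.ne_zero ?_
      · rw [degree_X_pow, degree_eq_natDegree hm.ne_zero]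
      · rw [hm.leadingCoeff, leadingCoeff_X_pow]
    have := lowPoly_coeff_eq_self hd
    simp only [lowPoly] at this
    rw [monicPoly, this, add_sub_cancel]

lemma card_lowPolys (n : ℕ) : (lowPolys F n).card = Fintype.card F ^ n := by
  classical
  rw [lowPolys, Finset.card_image_of_injective _ (lowPoly_injective n)]
  simp

lemma card_monicPolys (k : ℕ) : (monicPolys F k).card = Fintype.card F ^ k := by
  classical
  rw [monicPolys, Finset.card_image_of_injective _ (monicPoly_injective k)]
  simp

lemma sum_lowPolys {M : Type*} [AddCommMonoid M] (n : ℕ) (g : F[X] → M) :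
    ∑ f ∈ lowPolys F n, g f = ∑ x : Fin n → F, g (lowPoly F n x) := by
  classical
  rw [lowPolys, Finset.sum_image fun _ _ _ _ h => lowPoly_injective n h]

lemma sum_monicPolys {M : Type*} [AddCommMonoid M] (k : ℕ) (g : F[X] → M) :
    ∑ f ∈ monicPolys F k, g f = ∑ x : Fin k → F, g (monicPoly F k x) := by
  classical
  rw [monicPolys, Finset.sum_image fun _ _ _ _ h => monicPoly_injective k h]

open scoped Classical in
/-- The monic divisors of a nonzero polynomial `f`; empty for `f = 0`. -/
noncomputable def monicDivisors (f : F[X]) : Finset F[X] :=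
  (lowPolys F (f.natDegree + 1)).filter fun a => a.Monic ∧ a ∣ f ∧ f ≠ 0

lemma mem_monicDivisors {f a : F[X]} :
    a ∈ monicDivisors f ↔ a.Monic ∧ a ∣ f ∧ f ≠ 0 := by
  classical
  rw [monicDivisors, Finset.mem_filter, and_iff_right_iff_imp]
  rintro ⟨hm, hd, hf⟩
  rw [mem_lowPolys_iff_natDegree hm.ne_zero]
  exact Nat.lt_succ_of_le (natDegree_le_of_dvd hd hf)

@[simp] lemma monicDivisors_zero : monicDivisors (0 : F[X]) = ∅ := by
  ext a
  simp [mem_monicDivisors]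

lemma natDegree_le_of_mem_monicDivisors {f a : F[X]} (h : a ∈ monicDivisors f) :
    a.natDegree ≤ f.natDegree :=
  natDegree_le_of_dvd (mem_monicDivisors.1 h).2.1 (mem_monicDivisors.1 h).2.2

lemma exists_eq_mul_of_mem_monicDivisors {f a : F[X]} (h : a ∈ monicDivisors f) :
    ∃ w, w ≠ 0 ∧ f = a * w ∧ f / a = w := by
  obtain ⟨hm, ⟨w, rfl⟩, h0⟩ := mem_monicDivisors.1 h
  exact ⟨w, right_ne_zero_of_mul h0, rfl, mul_div_cancel_left₀ w hm.ne_zero⟩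

end Enumeration

section Moebius

variable {F : Type*} [Field F]

lemma polyMu_zero : polyMu (0 : F[X]) = 0 := by
  rw [polyMu, if_neg not_squarefree_zero]

lemma abs_polyMu_le_one (f : F[X]) : |polyMu f| ≤ 1 := by
  unfold polyMu
  split_ifs
  · rw [abs_pow]; simp
  · simp

lemma polyMu_one : polyMu (1 : F[X]) = 1 := by
  simp [polyMu]

lemma polyMu_eq_of_associated {f g : F[X]} (h : Associated f g) : polyMu f = polyMu g := by
  classical
  by_cases hf : f = 0
  · subst hf
    rw [(associated_zero_iff_eq_zero g).1 h.symm]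
  · have hg : g ≠ 0 := fun h0 => hf ((associated_zero_iff_eq_zero f).1 (h0 ▸ h))
    unfold polyMu
    rw [h.normalizedFactors_eq]
    simp only [h.squarefree_iff]

lemma squarefree_mul_of_irreducible {p e : F[X]} (hp : Irreducible p) (hpe : ¬ p ∣ e) :
    Squarefree (p * e) ↔ Squarefree e := by
  rw [squarefree_mul_iff]
  have : IsRelPrime p e := (hp.isRelPrime_iff_not_dvd).2 hpe
  simp [this, hp.squarefree]

lemma polyMu_irreducible_mul {p e : F[X]} (hp : Irreducible p) (hpe : ¬ p ∣ e) :
    polyMu (p * e) = -polyMu e := by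
  classical
  unfold polyMu
  by_cases h : Squarefree e
  · rw [if_pos h, if_pos ((squarefree_mul_of_irreducible hp hpe).2 h)]
    rw [UniqueFactorizationMonoid.normalizedFactors_mul hp.ne_zero h.ne_zero,
      UniqueFactorizationMonoid.normalizedFactors_irreducible hp]
    simp [pow_add]
  · rw [if_neg h, if_neg (mt (squarefree_mul_of_irreducible hp hpe).1 h), neg_zero]

variable [Fintype F]

lemma sum_polyMu_monicDivisors_of_not_isUnit {f : F[X]} (hu : ¬ IsUnit f) :
    ∑ d ∈ monicDivisors f, polyMu d = 0 := by
  classical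
  by_cases hf : f = 0
  · simp [hf]
  obtain ⟨p, hpm, hp, hpf⟩ := exists_monic_irreducible_factor f hu
  have hsq : ∑ d ∈ monicDivisors f, polyMu d
      = ∑ d ∈ (monicDivisors f).filter Squarefree, polyMu d := by
    rw [Finset.sum_filter]
    refine Finset.sum_congr rfl fun d _ => ?_
    split_ifs with h
    · rfl
    · rw [polyMu, if_neg h]
  rw [hsq]
  have hdiv : ∀ d : F[X], p ∣ d → p * (d / p) = d := fun d hd =>
    EuclideanDomain.mul_div_cancel' hp.ne_zero hd
  have hnd : ∀ d : F[X], Squarefree d → p ∣ d → ¬ p ∣ d / p := by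
    intro d hs hd hd'
    refine hp.not_isUnit (hs p ?_)
    calc p * p ∣ p * (d / p) := mul_dvd_mul_left p hd'
      _ = d := hdiv d hd
  refine Finset.sum_involution (fun d _ => if p ∣ d then d / p else p * d) ?_ ?_ ?_ ?_
  · intro d hd
    rw [Finset.mem_filter] at hd
    split_ifs with h
    · conv_lhs => rw [← hdiv d h]
      rw [polyMu_irreducible_mul hp (hnd d hd.2 h), hdiv d h]
      ring
    · rw [polyMu_irreducible_mul hp h]
      ring
  · intro d hd _ heq
    rw [Finset.mem_filter] at hd
    split_ifs at heq with h
    · exact hnd d hd.2 h (by rw [heq]; exact h)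
    · exact h ⟨d, heq.symm⟩
  · intro d hd
    rw [Finset.mem_filter, mem_monicDivisors] at hd
    obtain ⟨⟨hm, hdf, h0⟩, hs⟩ := hd
    rw [Finset.mem_filter, mem_monicDivisors]
    split_ifs with h
    · have hd' := hdiv d h
      have hdd : d / p ∣ d := ⟨p, by rw [mul_comm, hd']⟩
      exact ⟨⟨hpm.of_mul_monic_left (by rw [hd']; exact hm), hdd.trans hdf, h0⟩,
        hs.squarefree_of_dvd hdd⟩
    · refine ⟨⟨hpm.mul hm, ?_, h0⟩, (squarefree_mul_of_irreducible hp h).2 hs⟩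
      exact ((hp.isRelPrime_iff_not_dvd).2 h).mul_dvd hpf hdf
  · intro d hd
    by_cases h : p ∣ d
    · rw [Finset.mem_filter] at hd
      simp only [h, if_true, hnd d hd.2 h, if_false, hdiv d h]
    · simp only [h, if_false, dvd_mul_right, if_true]
      exact mul_div_cancel_left₀ d hp.ne_zero

lemma sum_polyMu_monicDivisors_of_isUnit {f : F[X]} (hu : IsUnit f) :
    ∑ d ∈ monicDivisors f, polyMu d = 1 := by
  have : monicDivisors f = {1} := by
    ext a
    rw [mem_monicDivisors, Finset.mem_singleton]
    constructor
    · rintro ⟨hm, hd, -⟩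
      exact hm.eq_one_of_isUnit (isUnit_of_dvd_unit hd hu)
    · rintro rfl
      exact ⟨monic_one, one_dvd _, hu.ne_zero⟩
  rw [this, Finset.sum_singleton, polyMu_one]

lemma sum_mul_sum_polyMu {f : F[X]} (hf : f ≠ 0) (g : F[X] → ℤ) :
    ∑ a ∈ monicDivisors f, g a * ∑ b ∈ monicDivisors (f / a), polyMu b
      = g (f * C f.leadingCoeff⁻¹) := by
  have hlc : IsUnit (C f.leadingCoeff⁻¹) :=
    isUnit_C.2 (inv_ne_zero (leadingCoeff_ne_zero.2 hf)).isUnit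
  have hass : Associated (f * C f.leadingCoeff⁻¹) f := associated_mul_unit_left f _ hlc
  have hmon : (f * C f.leadingCoeff⁻¹).Monic := monic_mul_leadingCoeff_inv hf
  have hmem : f * C f.leadingCoeff⁻¹ ∈ monicDivisors f :=
    mem_monicDivisors.2 ⟨hmon, hass.dvd, hf⟩
  rw [Finset.sum_eq_single_of_mem _ hmem]
  · obtain ⟨w, hw, hfw, hdiv⟩ := exists_eq_mul_of_mem_monicDivisors hmem
    rw [hdiv, sum_polyMu_monicDivisors_of_isUnit, mul_one]
    obtain ⟨v, hv⟩ := hass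
    have : w = v := by
      apply mul_left_cancel₀ hmon.ne_zero
      rw [← hfw, hv]
    rw [this]
    exact v.isUnit
  · intro a ha hne
    rw [sum_polyMu_monicDivisors_of_not_isUnit, mul_zero]
    intro hu
    obtain ⟨w, hw, hfw, hdiv⟩ := exists_eq_mul_of_mem_monicDivisors ha
    rw [hdiv] at hu
    have h1 : Associated f a := by
      conv_lhs => rw [hfw]
      exact associated_mul_unit_left a w hu
    exact hne (eq_of_monic_of_associated (mem_monicDivisors.1 ha).1 hmon (hass.trans h1).symm)

/-- Pairs `(a, b)` of monic polynomials with `a * b ∣ f` may be summed in either order. -/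
lemma sum_monicDivisors_comm {M : Type*} [AddCommMonoid M] (f : F[X]) (g : F[X] → F[X] → M) :
    ∑ a ∈ monicDivisors f, ∑ b ∈ monicDivisors (f / a), g a b
      = ∑ b ∈ monicDivisors f, ∑ a ∈ monicDivisors (f / b), g a b := by
  have key : ∀ a b : F[X], a ∈ monicDivisors f → b ∈ monicDivisors (f / a) →
      b ∈ monicDivisors f ∧ a ∈ monicDivisors (f / b) := by
    intro a b ha hb
    obtain ⟨w, hw, hfw, hdiv⟩ := exists_eq_mul_of_mem_monicDivisors ha
    rw [hdiv] at hb
    obtain ⟨v, hv, hwv, -⟩ := exists_eq_mul_of_mem_monicDivisors hb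
    have hf := (mem_monicDivisors.1 ha).2.2
    have hbm := (mem_monicDivisors.1 hb).1
    have e : f = b * (a * v) := by rw [hfw, hwv]; ring
    have hbf : b ∈ monicDivisors f := mem_monicDivisors.2 ⟨hbm, ⟨_, e⟩, hf⟩
    refine ⟨hbf, ?_⟩
    rw [e, mul_div_cancel_left₀ _ hbm.ne_zero]
    have ham := (mem_monicDivisors.1 ha).1
    exact mem_monicDivisors.2 ⟨ham, dvd_mul_right a v, mul_ne_zero ham.ne_zero hv⟩
  exact Finset.sum_comm' fun a b =>
    ⟨fun h => (key a b h.1 h.2).symm, fun h => key b a h.2 h.1⟩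

lemma sum_monicDivisors_assoc (f : F[X]) (g h : F[X] → ℤ) :
    ∑ d ∈ monicDivisors f, ∑ a ∈ monicDivisors d, g a * h (d / a)
      = ∑ a ∈ monicDivisors f, g a * ∑ b ∈ monicDivisors (f / a), h b := by
  simp only [Finset.mul_sum]
  rw [Finset.sum_sigma', Finset.sum_sigma']
  refine Finset.sum_bij' (fun x _ => ⟨x.2, x.1 / x.2⟩) (fun y _ => ⟨y.1 * y.2, y.1⟩)
    ?_ ?_ ?_ ?_ ?_
  · rintro ⟨d, a⟩ hx
    obtain ⟨hd, ha⟩ := Finset.mem_sigma.1 hx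
    dsimp only at hd ha ⊢
    obtain ⟨w, hw, hdw, hdiv⟩ := exists_eq_mul_of_mem_monicDivisors ha
    obtain ⟨v, hv, hfv, -⟩ := exists_eq_mul_of_mem_monicDivisors hd
    have ham := (mem_monicDivisors.1 ha).1
    have hdm := (mem_monicDivisors.1 hd).1
    rw [Finset.mem_sigma]
    dsimp only
    have e : f = a * (w * v) := by rw [hfv, hdw]; ring
    refine ⟨mem_monicDivisors.2 ⟨ham, ⟨_, e⟩, (mem_monicDivisors.1 hd).2.2⟩, ?_⟩
    rw [hdiv, e, mul_div_cancel_left₀ _ ham.ne_zero]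
    exact mem_monicDivisors.2
      ⟨ham.of_mul_monic_left (hdw ▸ hdm), dvd_mul_right w v, mul_ne_zero hw hv⟩
  · rintro ⟨a, b⟩ hx
    obtain ⟨ha, hb⟩ := Finset.mem_sigma.1 hx
    dsimp only at ha hb ⊢
    obtain ⟨w, hw, hfw, hdiv⟩ := exists_eq_mul_of_mem_monicDivisors ha
    rw [hdiv] at hb
    have ham := (mem_monicDivisors.1 ha).1
    obtain ⟨hbm, hbw, -⟩ := mem_monicDivisors.1 hb
    rw [Finset.mem_sigma]
    exact ⟨mem_monicDivisors.2 ⟨ham.mul hbm, hfw ▸ mul_dvd_mul_left a hbw,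
      (mem_monicDivisors.1 ha).2.2⟩, mem_monicDivisors.2 ⟨ham, dvd_mul_right a b,
      (ham.mul hbm).ne_zero⟩⟩
  · rintro ⟨d, a⟩ hx
    obtain ⟨hd, ha⟩ := Finset.mem_sigma.1 hx
    obtain ⟨w, hw, hdw, hdiv⟩ := exists_eq_mul_of_mem_monicDivisors ha
    dsimp only at hdw hdiv ⊢
    rw [hdiv, ← hdw]
  · rintro ⟨a, b⟩ hx
    obtain ⟨ha, hb⟩ := Finset.mem_sigma.1 hx
    have ham := (mem_monicDivisors.1 ha).1
    dsimp only at ham ⊢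
    rw [mul_div_cancel_left₀ _ ham.ne_zero]
  · rintro ⟨d, a⟩ _
    rfl

end Moebius

section DivisorSums

variable {F : Type*} [Field F] [Fintype F]

/-- Summing over `f = d * w` with `d` monic, organised by the degree of `d`. -/
lemma sum_sum_monicDivisors {M : Type*} [AddCommMonoid M] (N : ℕ) (S : Finset F[X])
    (T : ℕ → Finset F[X]) (hT0 : ∀ k, (0 : F[X]) ∉ T k)
    (hST : ∀ a v : F[X], a.Monic → v ≠ 0 →
      (a * v ∈ S ↔ a.natDegree < N ∧ v ∈ T a.natDegree))
    (G : F[X] → F[X] → M) :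
    ∑ f ∈ S, ∑ d ∈ monicDivisors f, G d (f / d)
      = ∑ k ∈ Finset.range N, ∑ d ∈ monicPolys F k, ∑ w ∈ T k, G d w := by
  rw [Finset.sum_sigma', Finset.sum_sigma', Finset.sum_sigma']
  refine Finset.sum_bij' (fun x _ => ⟨⟨x.2.natDegree, x.2⟩, x.1 / x.2⟩)
    (fun y _ => ⟨y.1.2 * y.2, y.1.2⟩) ?_ ?_ ?_ ?_ ?_
  · rintro ⟨f, d⟩ hx
    obtain ⟨hf, hd⟩ := Finset.mem_sigma.1 hx
    dsimp only at hf hd ⊢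
    obtain ⟨w, hw, hfw, hdiv⟩ := exists_eq_mul_of_mem_monicDivisors hd
    have hdm := (mem_monicDivisors.1 hd).1
    rw [hfw] at hf
    obtain ⟨h1, h2⟩ := (hST d w hdm hw).1 hf
    simp only [Finset.mem_sigma, Finset.mem_range, mem_monicPolys, hdiv, and_true]
    exact ⟨⟨h1, hdm⟩, h2⟩
  · rintro ⟨⟨k, d⟩, w⟩ hy
    simp only [Finset.mem_sigma, Finset.mem_range, mem_monicPolys] at hy ⊢
    obtain ⟨⟨hk, hdm, rfl⟩, hw⟩ := hy
    have hw0 : w ≠ 0 := fun h => hT0 _ (h ▸ hw)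
    exact ⟨(hST d w hdm hw0).2 ⟨hk, hw⟩,
      mem_monicDivisors.2 ⟨hdm, dvd_mul_right d w, mul_ne_zero hdm.ne_zero hw0⟩⟩
  · rintro ⟨f, d⟩ hx
    obtain ⟨hf, hd⟩ := Finset.mem_sigma.1 hx
    dsimp only at hd ⊢
    obtain ⟨w, hw, hfw, hdiv⟩ := exists_eq_mul_of_mem_monicDivisors hd
    rw [hdiv, ← hfw]
  · rintro ⟨⟨k, d⟩, w⟩ hy
    simp only [Finset.mem_sigma, Finset.mem_range, mem_monicPolys] at hy ⊢
    obtain ⟨⟨hk, hdm, rfl⟩, hw⟩ := hy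
    rw [mul_div_cancel_left₀ _ hdm.ne_zero]
  · rintro ⟨f, d⟩ _
    rfl

lemma card_monicDivisors_mul_le (a b : F[X]) :
    (monicDivisors (a * b)).card ≤ (monicDivisors a).card * (monicDivisors b).card := by
  classical
  rw [← Finset.card_product]
  refine le_trans (Finset.card_le_card ?_)
    (Finset.card_image_le (f := fun x : F[X] × F[X] => x.1 * x.2))
  intro c hc
  obtain ⟨hcm, hcd, h0⟩ := mem_monicDivisors.1 hc
  obtain ⟨c₁, c₂, h₁, h₂, rfl⟩ := exists_dvd_and_dvd_of_dvd_mul hcd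
  have hc₁ : c₁ ≠ 0 := left_ne_zero_of_mul hcm.ne_zero
  have hc₂ : c₂ ≠ 0 := right_ne_zero_of_mul hcm.ne_zero
  have aux : ∀ c e : F[X], c ≠ 0 → c ∣ e → e ≠ 0 →
      c * C c.leadingCoeff⁻¹ ∈ monicDivisors e := fun c e hc hce he =>
    mem_monicDivisors.2 ⟨monic_mul_leadingCoeff_inv hc,
      (associated_mul_unit_left c _
        (isUnit_C.2 (inv_ne_zero (leadingCoeff_ne_zero.2 hc)).isUnit)).dvd.trans hce, he⟩
  refine Finset.mem_image.2 ⟨(c₁ * C c₁.leadingCoeff⁻¹, c₂ * C c₂.leadingCoeff⁻¹),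
    Finset.mem_product.2 ⟨aux c₁ a hc₁ h₁ (left_ne_zero_of_mul h0),
      aux c₂ b hc₂ h₂ (right_ne_zero_of_mul h0)⟩, ?_⟩
  have hl : c₁.leadingCoeff * c₂.leadingCoeff = 1 := by
    rw [← leadingCoeff_mul, hcm.leadingCoeff]
  calc c₁ * C c₁.leadingCoeff⁻¹ * (c₂ * C c₂.leadingCoeff⁻¹)
      = c₁ * c₂ * C ((c₁.leadingCoeff * c₂.leadingCoeff)⁻¹) := by
        rw [mul_inv, C_mul]; ring
    _ = c₁ * c₂ := by rw [hl]; simp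

lemma sum_card_monicDivisors_le {Y : ℕ → Finset F[X]} (hY0 : ∀ k, (0 : F[X]) ∉ Y k)
    (hY : ∀ (m : ℕ) (a v : F[X]), a.Monic → v ≠ 0 →
      (a * v ∈ Y m ↔ a.natDegree < m + 1 ∧ v ∈ Y (m - a.natDegree)))
    (hcard : ∀ m, (Y m).card ≤ Fintype.card F ^ m) (m : ℕ) :
    ∑ w ∈ Y m, (monicDivisors w).card ≤ (m + 1) * Fintype.card F ^ m := by
  simp only [Finset.card_eq_sum_ones (monicDivisors _)]
  rw [sum_sum_monicDivisors (m + 1) (Y m) (fun k => Y (m - k)) (fun k => hY0 _) (hY m)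
    (fun _ _ => 1)]
  calc _ ≤ ∑ k ∈ Finset.range (m + 1), Fintype.card F ^ m := by
        refine Finset.sum_le_sum fun k hk => ?_
        have hk' : k ≤ m := Nat.lt_succ_iff.1 (Finset.mem_range.1 hk)
        rw [Finset.sum_const, Finset.sum_const, card_monicPolys, smul_eq_mul, smul_eq_mul, mul_one]
        calc _ ≤ Fintype.card F ^ k * Fintype.card F ^ (m - k) :=
              Nat.mul_le_mul_left _ (hcard _)
          _ = _ := by rw [← pow_add, Nat.add_sub_cancel' hk']
    _ = _ := by simp

lemma sum_card_monicDivisors_sq_le {Y : ℕ → Finset F[X]} (hY0 : ∀ k, (0 : F[X]) ∉ Y k)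
    (hY : ∀ (m : ℕ) (a v : F[X]), a.Monic → v ≠ 0 →
      (a * v ∈ Y m ↔ a.natDegree < m + 1 ∧ v ∈ Y (m - a.natDegree)))
    (hcard : ∀ m, (Y m).card ≤ Fintype.card F ^ m)
    (hmonic : ∀ k, ∑ d ∈ monicPolys F k, (monicDivisors d).card ≤ (k + 1) * Fintype.card F ^ k)
    (m : ℕ) :
    ∑ w ∈ Y m, (monicDivisors w).card ^ 2 ≤ (m + 1) ^ 3 * Fintype.card F ^ m := by
  calc ∑ w ∈ Y m, (monicDivisors w).card ^ 2
      = ∑ w ∈ Y m, ∑ d ∈ monicDivisors w, (monicDivisors (d * (w / d))).card := by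
        refine Finset.sum_congr rfl fun w _ => ?_
        rw [sq, ← smul_eq_mul, ← Finset.sum_const]
        refine Finset.sum_congr rfl fun d hd => ?_
        obtain ⟨v, -, hwv, hdiv⟩ := exists_eq_mul_of_mem_monicDivisors hd
        rw [hdiv, ← hwv]
    _ = ∑ k ∈ Finset.range (m + 1), ∑ d ∈ monicPolys F k, ∑ w ∈ Y (m - k),
          (monicDivisors (d * w)).card :=
        sum_sum_monicDivisors (m + 1) (Y m) (fun k => Y (m - k)) (fun k => hY0 _) (hY m)
          (fun d w => (monicDivisors (d * w)).card)
    _ ≤ ∑ k ∈ Finset.range (m + 1), (m + 1) ^ 2 * Fintype.card F ^ m := by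
        refine Finset.sum_le_sum fun k hk => ?_
        have hk' : k ≤ m := Nat.lt_succ_iff.1 (Finset.mem_range.1 hk)
        calc _ ≤ ∑ d ∈ monicPolys F k, ∑ w ∈ Y (m - k),
              (monicDivisors d).card * (monicDivisors w).card :=
              Finset.sum_le_sum fun d _ => Finset.sum_le_sum fun w _ =>
                card_monicDivisors_mul_le d w
          _ = (∑ d ∈ monicPolys F k, (monicDivisors d).card) *
                ∑ w ∈ Y (m - k), (monicDivisors w).card := (Finset.sum_mul_sum _ _ _ _).symm
          _ ≤ ((k + 1) * Fintype.card F ^ k) * ((m - k + 1) * Fintype.card F ^ (m - k)) :=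
              Nat.mul_le_mul (hmonic k) (sum_card_monicDivisors_le hY0 hY hcard _)
          _ = ((k + 1) * (m - k + 1)) * Fintype.card F ^ m := by
              conv_rhs => rw [← Nat.add_sub_cancel' hk', pow_add]
              rw [Nat.add_sub_cancel' hk']
              ring
          _ ≤ _ := by
              rw [sq]
              gcongr
              omega
    _ = _ := by
        simp only [Finset.sum_const, Finset.card_range, smul_eq_mul]
        ring

lemma zero_notMem_monicPolys (k : ℕ) : (0 : F[X]) ∉ monicPolys F k := fun h =>
  (mem_monicPolys.1 h).1.ne_zero rfl

lemma mul_mem_monicPolys_iff (m : ℕ) (a v : F[X]) (ha : a.Monic) (hv : v ≠ 0) :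
    a * v ∈ monicPolys F m ↔ a.natDegree < m + 1 ∧ v ∈ monicPolys F (m - a.natDegree) := by
  rw [mem_monicPolys, mem_monicPolys, natDegree_mul ha.ne_zero hv]
  constructor
  · rintro ⟨h1, h2⟩
    exact ⟨by omega, ha.of_mul_monic_left h1, by omega⟩
  · rintro ⟨h1, h2, h3⟩
    exact ⟨ha.mul h2, by omega⟩

lemma sum_monicPolys_card_monicDivisors_le (k : ℕ) :
    ∑ d ∈ monicPolys F k, (monicDivisors d).card ≤ (k + 1) * Fintype.card F ^ k :=
  sum_card_monicDivisors_le zero_notMem_monicPolys mul_mem_monicPolys_iff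
    (fun m => (card_monicPolys m).le) k

lemma sum_monicPolys_card_monicDivisors_sq_le (k : ℕ) :
    ∑ d ∈ monicPolys F k, (monicDivisors d).card ^ 2 ≤ (k + 1) ^ 3 * Fintype.card F ^ k :=
  sum_card_monicDivisors_sq_le zero_notMem_monicPolys mul_mem_monicPolys_iff
    (fun m => (card_monicPolys m).le) sum_monicPolys_card_monicDivisors_le k

open scoped Classical in
lemma mul_mem_lowPolys_filter_iff (m : ℕ) (a v : F[X]) (ha : a.Monic) (hv : v ≠ 0) :
    a * v ∈ (lowPolys F m).filter (· ≠ 0) ↔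
      a.natDegree < m + 1 ∧ v ∈ (lowPolys F (m - a.natDegree)).filter (· ≠ 0) := by
  have hav : a * v ≠ 0 := mul_ne_zero ha.ne_zero hv
  rw [Finset.mem_filter, Finset.mem_filter, mem_lowPolys_iff_natDegree hav,
    mem_lowPolys_iff_natDegree hv, natDegree_mul ha.ne_zero hv]
  constructor
  · rintro ⟨h1, -⟩
    exact ⟨by omega, by omega, hv⟩
  · rintro ⟨h1, h2, -⟩
    exact ⟨by omega, hav⟩

lemma sum_lowPolys_card_monicDivisors_sq_le (m : ℕ) :
    ∑ w ∈ lowPolys F m, (monicDivisors w).card ^ 2 ≤ (m + 1) ^ 3 * Fintype.card F ^ m := by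
  classical
  rw [← Finset.sum_filter_of_ne (p := (· ≠ 0))]
  · exact sum_card_monicDivisors_sq_le (Y := fun m => (lowPolys F m).filter (· ≠ 0))
      (fun k => by simp) mul_mem_lowPolys_filter_iff
      (fun m => (Finset.card_filter_le _ _).trans (card_lowPolys m).le)
      sum_monicPolys_card_monicDivisors_le m
  · rintro w - hw rfl
    simp at hw

open scoped Classical in
lemma sum_lowPolys_sum_monicDivisors {M : Type*} [AddCommMonoid M] (n : ℕ)
    (G : F[X] → F[X] → M) :
    ∑ f ∈ lowPolys F n, ∑ d ∈ monicDivisors f, G d (f / d)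
      = ∑ k ∈ Finset.range (n + 1), ∑ d ∈ monicPolys F k,
          ∑ w ∈ (lowPolys F (n - k)).filter (· ≠ 0), G d w := by
  rw [← sum_sum_monicDivisors (n + 1) ((lowPolys F n).filter (· ≠ 0))
    (fun k => (lowPolys F (n - k)).filter (· ≠ 0)) (fun k => by simp)
    (mul_mem_lowPolys_filter_iff n) G]
  refine (Finset.sum_filter_of_ne ?_).symm
  rintro f - hf rfl
  simp at hf

end DivisorSums

section Vaughan

variable {F : Type*} [Field F]

/-- The Möbius function restricted to degree `≤ u`. -/
noncomputable def polyMuLow (u : ℕ) (f : F[X]) : ℤ := if f.natDegree ≤ u then polyMu f else 0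

/-- The Möbius function restricted to degree `> u`. -/
noncomputable def polyMuHigh (u : ℕ) (f : F[X]) : ℤ := if f.natDegree ≤ u then 0 else polyMu f

lemma polyMuHigh_eq_sub (u : ℕ) (f : F[X]) : polyMuHigh u f = polyMu f - polyMuLow u f := by
  unfold polyMuHigh polyMuLow
  split_ifs <;> ring

lemma abs_polyMuLow_le_one (u : ℕ) (f : F[X]) : |polyMuLow u f| ≤ 1 := by
  unfold polyMuLow
  split_ifs
  · exact abs_polyMu_le_one f
  · simp

lemma abs_polyMuHigh_le_one (u : ℕ) (f : F[X]) : |polyMuHigh u f| ≤ 1 := by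
  unfold polyMuHigh
  split_ifs
  · simp
  · exact abs_polyMu_le_one f

lemma polyMu_mul_C_inv {f : F[X]} (hf : f ≠ 0) :
    polyMu (f * C f.leadingCoeff⁻¹) = polyMu f :=
  polyMu_eq_of_associated (associated_mul_unit_left f _
    (isUnit_C.2 (inv_ne_zero (leadingCoeff_ne_zero.2 hf)).isUnit))

lemma polyMuLow_mul_C_inv {f : F[X]} (hf : f ≠ 0) (u : ℕ) :
    polyMuLow u (f * C f.leadingCoeff⁻¹) = polyMuLow u f := by
  unfold polyMuLow
  rw [polyMu_mul_C_inv hf, natDegree_mul_C (inv_ne_zero (leadingCoeff_ne_zero.2 hf))]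

variable [Fintype F]

/-- The convolution `(μ_{≤u} * μ_{≤u})(d)`. -/
noncomputable def typeOneCoeff (u : ℕ) (d : F[X]) : ℤ :=
  ∑ a ∈ monicDivisors d, polyMuLow u a * polyMuLow u (d / a)

/-- The convolution `(μ_{>u} * 1)(w)`, set to `0` at `w = 0`. -/
noncomputable def typeTwoCoeff (u : ℕ) (w : F[X]) : ℤ :=
  ∑ b ∈ monicDivisors w, polyMuHigh u b

lemma abs_typeOneCoeff_le (u : ℕ) (d : F[X]) : |typeOneCoeff u d| ≤ (monicDivisors d).card := by
  refine (Finset.abs_sum_le_sum_abs _ _).trans ?_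
  rw [Finset.card_eq_sum_ones, Nat.cast_sum]
  refine Finset.sum_le_sum fun a _ => ?_
  rw [abs_mul]
  exact mul_le_one₀ (abs_polyMuLow_le_one u a) (abs_nonneg _) (abs_polyMuLow_le_one u _)

lemma abs_typeTwoCoeff_le (u : ℕ) (w : F[X]) : |typeTwoCoeff u w| ≤ (monicDivisors w).card := by
  refine (Finset.abs_sum_le_sum_abs _ _).trans ?_
  rw [Finset.card_eq_sum_ones, Nat.cast_sum]
  exact Finset.sum_le_sum fun b _ => abs_polyMuHigh_le_one u b

lemma typeTwoCoeff_zero (u : ℕ) : typeTwoCoeff u (0 : F[X]) = 0 := by simp [typeTwoCoeff]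

lemma typeTwoCoeff_eq_zero {u : ℕ} {w : F[X]} (h : w.natDegree ≤ u) : typeTwoCoeff u w = 0 :=
  Finset.sum_eq_zero fun _ hb => if_pos ((natDegree_le_of_mem_monicDivisors hb).trans h)

lemma typeOneCoeff_eq_zero {u : ℕ} {d : F[X]} (h : 2 * u < d.natDegree) :
    typeOneCoeff u d = 0 := by
  refine Finset.sum_eq_zero fun a ha => ?_
  obtain ⟨w, hw, hdw, hdiv⟩ := exists_eq_mul_of_mem_monicDivisors ha
  rw [hdw, natDegree_mul (mem_monicDivisors.1 ha).1.ne_zero hw] at h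
  rw [hdiv]
  unfold polyMuLow
  by_cases h1 : a.natDegree ≤ u
  · rw [if_neg (show ¬ w.natDegree ≤ u by omega), mul_zero]
  · rw [if_neg h1, zero_mul]

lemma sum_typeOneCoeff (u : ℕ) (f : F[X]) :
    ∑ d ∈ monicDivisors f, typeOneCoeff u d
      = ∑ a ∈ monicDivisors f, polyMuLow u a * ∑ b ∈ monicDivisors (f / a), polyMuLow u b :=
  sum_monicDivisors_assoc f _ _

/-- Vaughan's identity. -/
lemma polyMu_eq_typeTwo_sub_typeOne (u : ℕ) (f : F[X]) :
    polyMu f = 2 * polyMuLow u f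
      + ∑ a ∈ monicDivisors f, polyMuHigh u a * typeTwoCoeff u (f / a)
      - ∑ d ∈ monicDivisors f, typeOneCoeff u d := by
  by_cases hf : f = 0
  · subst hf
    simp [polyMu_zero, polyMuLow]
  have hmm := sum_mul_sum_polyMu hf polyMu
  have hlm := sum_mul_sum_polyMu hf (polyMuLow u)
  rw [polyMu_mul_C_inv hf] at hmm
  rw [polyMuLow_mul_C_inv hf] at hlm
  have hml : ∑ a ∈ monicDivisors f, polyMu a * ∑ b ∈ monicDivisors (f / a), polyMuLow u b
      = polyMuLow u f := by
    rw [← hlm]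
    simp only [Finset.mul_sum]
    rw [sum_monicDivisors_comm]
    simp only [mul_comm]
  rw [sum_typeOneCoeff]
  have hhh : ∑ a ∈ monicDivisors f, polyMuHigh u a * typeTwoCoeff u (f / a)
      = polyMu f - polyMuLow u f - polyMuLow u f
        + ∑ a ∈ monicDivisors f, polyMuLow u a * ∑ b ∈ monicDivisors (f / a), polyMuLow u b := by
    conv_rhs => rw [← hmm]
    nth_rewrite 1 [← hlm]
    rw [← hml, ← Finset.sum_sub_distrib, ← Finset.sum_sub_distrib, ← Finset.sum_add_distrib]
    refine Finset.sum_congr rfl fun a _ => ?_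
    simp only [typeTwoCoeff, polyMuHigh_eq_sub, Finset.sum_sub_distrib]
    ring
  rw [hhh]
  ring

end Vaughan

section CauchySchwarz

variable {ι κ : Type*}

lemma norm_sum_mul_sq_le (s : Finset ι) (a b : ι → ℂ) :
    ‖∑ i ∈ s, a i * b i‖ ^ 2 ≤ (∑ i ∈ s, ‖a i‖ ^ 2) * ∑ i ∈ s, ‖b i‖ ^ 2 := by
  refine le_trans ?_ (Finset.sum_mul_sq_le_sq_mul_sq s (fun i => ‖a i‖) fun i => ‖b i‖)
  gcongr
  refine (norm_sum_le _ _).trans (le_of_eq ?_)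
  simp only [norm_mul]

open ComplexConjugate in
lemma ofReal_sum_norm_sq_corr (s : Finset ι) (t : Finset κ) (φ : ι → κ → ℂ) :
    ((∑ i ∈ s, ∑ i' ∈ s, ‖∑ w ∈ t, φ i w * conj (φ i' w)‖ ^ 2 : ℝ) : ℂ)
      = ∑ p ∈ s ×ˢ s, ∑ r ∈ t ×ˢ t,
          φ p.1 r.1 * conj (φ p.2 r.1) * (conj (φ p.1 r.2) * φ p.2 r.2) := by
  push_cast
  rw [← Finset.sum_product']
  refine Finset.sum_congr rfl fun p _ => ?_
  rw [← Complex.mul_conj', map_sum, Finset.sum_mul_sum, ← Finset.sum_product']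
  refine Finset.sum_congr rfl fun r _ => ?_
  simp only [map_mul, Complex.conj_conj]

open ComplexConjugate in
/-- The box norm of a kernel may be computed by pairing either variable first. -/
lemma sum_norm_sq_corr_comm (s : Finset ι) (t : Finset κ) (φ : ι → κ → ℂ) :
    ∑ i ∈ s, ∑ i' ∈ s, ‖∑ w ∈ t, φ i w * conj (φ i' w)‖ ^ 2
      = ∑ w ∈ t, ∑ w' ∈ t, ‖∑ i ∈ s, φ i w * conj (φ i w')‖ ^ 2 := by
  apply Complex.ofReal_injective
  rw [ofReal_sum_norm_sq_corr, ofReal_sum_norm_sq_corr t s fun w i => φ i w, Finset.sum_comm]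
  refine Finset.sum_congr rfl fun r _ => Finset.sum_congr rfl fun p _ => ?_
  ring

open ComplexConjugate in
/-- Two applications of Cauchy–Schwarz remove bounded weights from a bilinear sum. -/
lemma norm_bilinear_sum_pow_four_le (s : Finset ι) (t : Finset κ) (φ : ι → κ → ℂ)
    (m : ι → ℂ) (hm : ∀ i, ‖m i‖ ≤ 1) (b : κ → ℂ) :
    ‖∑ i ∈ s, m i * ∑ w ∈ t, φ i w * b w‖ ^ 4
      ≤ (∑ w ∈ t, ‖b w‖ ^ 2) ^ 2 * ((s.card : ℝ) ^ 2 *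
          ∑ w ∈ t, ∑ w' ∈ t, ‖∑ i ∈ s, φ i w * conj (φ i w')‖ ^ 2) := by
  set V : ℝ := ∑ w ∈ t, ‖∑ i ∈ s, m i * φ i w‖ ^ 2 with hV
  have hV0 : 0 ≤ V := Finset.sum_nonneg fun _ _ => by positivity
  have h1 : ‖∑ i ∈ s, m i * ∑ w ∈ t, φ i w * b w‖ ^ 2 ≤ (∑ w ∈ t, ‖b w‖ ^ 2) * V := by
    have : ∑ i ∈ s, m i * ∑ w ∈ t, φ i w * b w = ∑ w ∈ t, b w * ∑ i ∈ s, m i * φ i w := by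
      simp only [Finset.mul_sum]
      rw [Finset.sum_comm]
      refine Finset.sum_congr rfl fun w _ => Finset.sum_congr rfl fun i _ => ?_
      ring
    rw [this]
    exact norm_sum_mul_sq_le t b _
  have h2 : (V : ℂ) = ∑ i ∈ s, ∑ i' ∈ s,
      m i * conj (m i') * ∑ w ∈ t, φ i w * conj (φ i' w) := by
    rw [hV]
    push_cast
    have hw : ∀ w ∈ t, (‖∑ i ∈ s, m i * φ i w‖ : ℂ) ^ 2
        = ∑ i ∈ s, ∑ i' ∈ s, m i * conj (m i') * (φ i w * conj (φ i' w)) := fun w _ => by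
      rw [← Complex.mul_conj', map_sum, Finset.sum_mul_sum]
      refine Finset.sum_congr rfl fun i _ => Finset.sum_congr rfl fun i' _ => ?_
      rw [map_mul]
      ring
    rw [Finset.sum_congr rfl hw, Finset.sum_comm]
    refine Finset.sum_congr rfl fun i _ => ?_
    rw [Finset.sum_comm]
    simp only [Finset.mul_sum]
  have h3 : V ≤ ∑ p ∈ s ×ˢ s, ‖∑ w ∈ t, φ p.1 w * conj (φ p.2 w)‖ := by
    calc V = ‖(V : ℂ)‖ := by rw [Complex.norm_real, Real.norm_of_nonneg hV0]
      _ ≤ _ := by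
        rw [h2, ← Finset.sum_product']
        refine (norm_sum_le _ _).trans (Finset.sum_le_sum fun p _ => ?_)
        rw [norm_mul, norm_mul, RCLike.norm_conj]
        exact mul_le_of_le_one_left (norm_nonneg _)
          (mul_le_one₀ (hm _) (norm_nonneg _) (hm _))
  have h4 : V ^ 2 ≤ (s.card : ℝ) ^ 2 *
      ∑ w ∈ t, ∑ w' ∈ t, ‖∑ i ∈ s, φ i w * conj (φ i w')‖ ^ 2 := by
    calc V ^ 2 ≤ (∑ p ∈ s ×ˢ s, ‖∑ w ∈ t, φ p.1 w * conj (φ p.2 w)‖) ^ 2 := by gcongr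
      _ ≤ ((s ×ˢ s).card : ℝ) * ∑ p ∈ s ×ˢ s, ‖∑ w ∈ t, φ p.1 w * conj (φ p.2 w)‖ ^ 2 :=
        sq_sum_le_card_mul_sum_sq
      _ = _ := by
        rw [Finset.card_product, Nat.cast_mul, ← sq, ← sum_norm_sq_corr_comm,
          Finset.sum_product]
  calc _ = (‖∑ i ∈ s, m i * ∑ w ∈ t, φ i w * b w‖ ^ 2) ^ 2 := by ring
    _ ≤ ((∑ w ∈ t, ‖b w‖ ^ 2) * V) ^ 2 := by gcongr
    _ = (∑ w ∈ t, ‖b w‖ ^ 2) ^ 2 * V ^ 2 := by ring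
    _ ≤ _ := by gcongr

end CauchySchwarz

section Decomposition

variable {F : Type*} [Field F] [Fintype F]

/-- The type I sum over monic `d` of degree `k`. -/
noncomputable def typeOneSum (n u : ℕ) (Φ : F[X] → ℂ) (k : ℕ) : ℂ :=
  ∑ d ∈ monicPolys F k, (typeOneCoeff u d : ℂ) * ∑ w ∈ lowPolys F (n - k), Φ (d * w)

/-- The type II sum over monic `d` of degree `k`. -/
noncomputable def typeTwoSum (n u : ℕ) (Φ : F[X] → ℂ) (k : ℕ) : ℂ :=
  ∑ d ∈ monicPolys F k, (polyMuHigh u d : ℂ) *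
    ∑ w ∈ lowPolys F (n - k), Φ (d * w) * (typeTwoCoeff u w : ℂ)

lemma typeOneSum_eq_zero {n u k : ℕ} (Φ : F[X] → ℂ) (h : 2 * u < k) :
    typeOneSum n u Φ k = 0 := by
  refine Finset.sum_eq_zero fun d hd => ?_
  rw [typeOneCoeff_eq_zero (by rw [(mem_monicPolys.1 hd).2]; exact h)]
  simp

lemma typeTwoSum_eq_zero_of_le {n u k : ℕ} (Φ : F[X] → ℂ) (h : k ≤ u) :
    typeTwoSum n u Φ k = 0 := by
  refine Finset.sum_eq_zero fun d hd => ?_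
  rw [polyMuHigh, if_pos (by rw [(mem_monicPolys.1 hd).2]; exact h)]
  simp

lemma natDegree_le_of_mem_lowPolys {m u : ℕ} {w : F[X]} (hw : w ∈ lowPolys F m)
    (h : m ≤ u + 1) : w.natDegree ≤ u := by
  by_cases h0 : w = 0
  · simp [h0]
  · have := (mem_lowPolys_iff_natDegree h0).1 hw
    omega

lemma typeTwoSum_eq_zero_of_sub_le {n u k : ℕ} (Φ : F[X] → ℂ) (h : n - k ≤ u + 1) :
    typeTwoSum n u Φ k = 0 := by
  refine Finset.sum_eq_zero fun d _ => ?_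
  rw [Finset.sum_eq_zero, mul_zero]
  intro w hw
  rw [typeTwoCoeff_eq_zero (natDegree_le_of_mem_lowPolys hw h)]
  simp

lemma sum_typeTwo (n u : ℕ) (Φ : F[X] → ℂ) :
    ∑ f ∈ lowPolys F n,
        ((∑ a ∈ monicDivisors f, polyMuHigh u a * typeTwoCoeff u (f / a) : ℤ) : ℂ) * Φ f
      = ∑ k ∈ Finset.range n, typeTwoSum n u Φ k := by
  classical
  have h := sum_lowPolys_sum_monicDivisors n
    (fun d w : F[X] => (polyMuHigh u d : ℂ) * (Φ (d * w) * (typeTwoCoeff u w : ℂ)))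
  calc _ = ∑ f ∈ lowPolys F n, ∑ d ∈ monicDivisors f,
        (polyMuHigh u d : ℂ) * (Φ (d * (f / d)) * (typeTwoCoeff u (f / d) : ℂ)) := by
        refine Finset.sum_congr rfl fun f _ => ?_
        push_cast
        rw [Finset.sum_mul]
        refine Finset.sum_congr rfl fun d hd => ?_
        obtain ⟨w, -, hfw, hdiv⟩ := exists_eq_mul_of_mem_monicDivisors hd
        rw [hdiv, ← hfw]
        ring
    _ = ∑ k ∈ Finset.range (n + 1), typeTwoSum n u Φ k := by
        rw [h]
        refine Finset.sum_congr rfl fun k _ => Finset.sum_congr rfl fun d _ => ?_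
        rw [← Finset.mul_sum]
        congr 1
        refine Finset.sum_filter_of_ne ?_
        rintro w - hw rfl
        simp [typeTwoCoeff_zero] at hw
    _ = _ := by
        rw [Finset.sum_range_succ, typeTwoSum_eq_zero_of_sub_le Φ (by omega), add_zero]

lemma sum_typeOne {n u : ℕ} (hu : 2 * u < n) (Φ : F[X] → ℂ) :
    ∑ f ∈ lowPolys F n, ((∑ d ∈ monicDivisors f, typeOneCoeff u d : ℤ) : ℂ) * Φ f
      = ∑ k ∈ Finset.range n, typeOneSum n u Φ k
        - (∑ k ∈ Finset.range n, ∑ d ∈ monicPolys F k, (typeOneCoeff u d : ℂ)) * Φ 0 := by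
  classical
  have h := sum_lowPolys_sum_monicDivisors n
    (fun d w : F[X] => (typeOneCoeff u d : ℂ) * Φ (d * w))
  calc _ = ∑ f ∈ lowPolys F n, ∑ d ∈ monicDivisors f,
        (typeOneCoeff u d : ℂ) * Φ (d * (f / d)) := by
        refine Finset.sum_congr rfl fun f _ => ?_
        push_cast
        rw [Finset.sum_mul]
        refine Finset.sum_congr rfl fun d hd => ?_
        obtain ⟨w, -, hfw, hdiv⟩ := exists_eq_mul_of_mem_monicDivisors hd
        rw [hdiv, ← hfw]
    _ = ∑ k ∈ Finset.range n, ∑ d ∈ monicPolys F k,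
          ∑ w ∈ (lowPolys F (n - k)).filter (· ≠ 0), (typeOneCoeff u d : ℂ) * Φ (d * w) := by
        rw [h, Finset.sum_range_succ, add_eq_left]
        refine Finset.sum_eq_zero fun d hd => ?_
        rw [typeOneCoeff_eq_zero (by rw [(mem_monicPolys.1 hd).2]; exact hu)]
        simp
    _ = _ := by
        rw [Finset.sum_mul, ← Finset.sum_sub_distrib]
        refine Finset.sum_congr rfl fun k _ => ?_
        rw [typeOneSum, Finset.sum_mul, ← Finset.sum_sub_distrib]
        refine Finset.sum_congr rfl fun d _ => ?_
        have h0 : (0 : F[X]) ∈ lowPolys F (n - k) := by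
          rw [mem_lowPolys, degree_zero]
          exact WithBot.bot_lt_coe _
        rw [← Finset.mul_sum, ← mul_sub, Finset.filter_ne', ← Finset.sum_erase_add _ _ h0, mul_zero,
          add_sub_cancel_right]

lemma sum_polyMu_mul_eq {n u : ℕ} (hu : 2 * u < n) (Φ : F[X] → ℂ) :
    ∑ f ∈ lowPolys F n, (polyMu f : ℂ) * Φ f
      = 2 * ∑ f ∈ lowPolys F n, (polyMuLow u f : ℂ) * Φ f
        + ∑ k ∈ Finset.range n, typeTwoSum n u Φ k
        - ∑ k ∈ Finset.range n, typeOneSum n u Φ k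
        + (∑ k ∈ Finset.range n, ∑ d ∈ monicPolys F k, (typeOneCoeff u d : ℂ)) * Φ 0 := by
  rw [← sum_typeTwo, sub_add, ← sum_typeOne hu, Finset.mul_sum, ← Finset.sum_add_distrib,
    ← Finset.sum_sub_distrib]
  refine Finset.sum_congr rfl fun f _ => ?_
  rw [polyMu_eq_typeTwo_sub_typeOne u f]
  push_cast
  ring

lemma norm_intCast_le_one {z : ℤ} (h : |z| ≤ 1) : ‖(z : ℂ)‖ ≤ 1 := by
  rw [Complex.norm_intCast]
  exact_mod_cast h

lemma norm_sum_polyMuLow_mul_le (n u : ℕ) (Φ : F[X] → ℂ) (hΦ : ∀ f, ‖Φ f‖ ≤ 1) :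
    ‖∑ f ∈ lowPolys F n, (polyMuLow u f : ℂ) * Φ f‖ ≤ (Fintype.card F : ℝ) ^ (u + 1) := by
  classical
  calc _ ≤ ∑ f ∈ lowPolys F n, if f ∈ lowPolys F (u + 1) then (1 : ℝ) else 0 := by
        refine (norm_sum_le _ _).trans (Finset.sum_le_sum fun f _ => ?_)
        split_ifs with hf
        · rw [norm_mul]
          exact mul_le_one₀ (norm_intCast_le_one (abs_polyMuLow_le_one u f)) (norm_nonneg _) (hΦ f)
        · rw [polyMuLow, if_neg]
          · simp
          · intro h
            exact hf (mem_lowPolys.2 (degree_le_natDegree.trans_lt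
              (by exact_mod_cast Nat.lt_succ_of_le h)))
    _ = (((lowPolys F n).filter (· ∈ lowPolys F (u + 1))).card : ℝ) := Finset.sum_boole _ _
    _ ≤ ((lowPolys F (u + 1)).card : ℝ) := by
        exact_mod_cast Finset.card_le_card fun f hf => (Finset.mem_filter.1 hf).2
    _ = _ := by rw [card_lowPolys]; push_cast; rfl

lemma two_mul_add_one_le_pow {q : ℕ} (hq : 3 ≤ q) (u : ℕ) : 2 * u + 1 ≤ q ^ u := by
  induction u with
  | zero => simp
  | succ u ih =>
    rw [pow_succ]
    nlinarith

lemma norm_sum_typeOneCoeff_le (hq : 3 ≤ Fintype.card F) {n u : ℕ} (hu : 2 * u < n) :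
    ‖∑ k ∈ Finset.range n, ∑ d ∈ monicPolys F k, (typeOneCoeff u d : ℂ)‖
      ≤ (Fintype.card F : ℝ) ^ (4 * u) := by
  have hsub : ∑ k ∈ Finset.range n, ∑ d ∈ monicPolys F k, ‖(typeOneCoeff u d : ℂ)‖
      = ∑ k ∈ Finset.range (2 * u + 1), ∑ d ∈ monicPolys F k, ‖(typeOneCoeff u d : ℂ)‖ := by
    refine (Finset.sum_subset (Finset.range_subset_range.2 hu) fun k _ hk => ?_).symm
    refine Finset.sum_eq_zero fun d hd => ?_
    rw [Finset.mem_range] at hk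
    rw [typeOneCoeff_eq_zero (by rw [(mem_monicPolys.1 hd).2]; omega)]
    simp
  have hnat : ∑ k ∈ Finset.range (2 * u + 1), ∑ d ∈ monicPolys F k, (monicDivisors d).card
      ≤ Fintype.card F ^ (4 * u) := by
    calc _ ≤ ∑ k ∈ Finset.range (2 * u + 1), (2 * u + 1) * Fintype.card F ^ (2 * u) := by
          refine Finset.sum_le_sum fun k hk => ?_
          rw [Finset.mem_range] at hk
          refine (sum_monicPolys_card_monicDivisors_le k).trans ?_
          refine Nat.mul_le_mul (by omega) (Nat.pow_le_pow_right (by omega) (by omega))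
      _ = (2 * u + 1) * (2 * u + 1) * Fintype.card F ^ (2 * u) := by
          simp only [Finset.sum_const, Finset.card_range, smul_eq_mul]
          ring
      _ ≤ Fintype.card F ^ u * Fintype.card F ^ u * Fintype.card F ^ (2 * u) := by
          gcongr <;> exact two_mul_add_one_le_pow hq u
      _ = _ := by rw [← pow_add, ← pow_add]; congr 1; ring
  calc _ ≤ ∑ k ∈ Finset.range n, ∑ d ∈ monicPolys F k, ‖(typeOneCoeff u d : ℂ)‖ :=
        (norm_sum_le _ _).trans (Finset.sum_le_sum fun k _ => norm_sum_le _ _)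
    _ = _ := hsub
    _ ≤ ∑ k ∈ Finset.range (2 * u + 1), ∑ d ∈ monicPolys F k, ((monicDivisors d).card : ℝ) := by
        refine Finset.sum_le_sum fun k _ => Finset.sum_le_sum fun d _ => ?_
        rw [Complex.norm_intCast]
        exact_mod_cast abs_typeOneCoeff_le u d
    _ ≤ _ := by exact_mod_cast hnat

lemma norm_typeOneSum_sq_le {n k : ℕ} (hk : k < n) (u : ℕ) (Φ : F[X] → ℂ) :
    ‖typeOneSum n u Φ k‖ ^ 2 ≤ (n : ℝ) ^ 3 * (Fintype.card F : ℝ) ^ k *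
      ∑ d ∈ monicPolys F k, ‖∑ w ∈ lowPolys F (n - k), Φ (d * w)‖ ^ 2 := by
  refine (norm_sum_mul_sq_le _ _ _).trans ?_
  gcongr
  calc ∑ d ∈ monicPolys F k, ‖(typeOneCoeff u d : ℂ)‖ ^ 2
      ≤ ∑ d ∈ monicPolys F k, ((monicDivisors d).card : ℝ) ^ 2 := by
        refine Finset.sum_le_sum fun d _ => ?_
        gcongr
        rw [Complex.norm_intCast]
        exact_mod_cast abs_typeOneCoeff_le u d
    _ ≤ ((k : ℝ) + 1) ^ 3 * (Fintype.card F : ℝ) ^ k := by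
        exact_mod_cast sum_monicPolys_card_monicDivisors_sq_le k
    _ ≤ _ := by
        gcongr
        exact_mod_cast hk

lemma norm_typeTwoSum_pow_four_le {n k : ℕ} (hk0 : 0 < k) (hk : k < n) (u : ℕ) (Φ : F[X] → ℂ) :
    ‖typeTwoSum n u Φ k‖ ^ 4 ≤ ((n : ℝ) ^ 3 * (Fintype.card F : ℝ) ^ (n - k)) ^ 2 *
      (((Fintype.card F : ℝ) ^ k) ^ 2 * ∑ w ∈ lowPolys F (n - k), ∑ w' ∈ lowPolys F (n - k),
        ‖∑ d ∈ monicPolys F k, Φ (d * w) * (starRingEnd ℂ) (Φ (d * w'))‖ ^ 2) := by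
  refine (norm_bilinear_sum_pow_four_le (monicPolys F k) (lowPolys F (n - k))
    (fun d w => Φ (d * w)) (fun d => (polyMuHigh u d : ℂ))
    (fun d => norm_intCast_le_one (abs_polyMuHigh_le_one u d)) _).trans ?_
  rw [card_monicPolys, Nat.cast_pow]
  gcongr
  calc ∑ w ∈ lowPolys F (n - k), ‖(typeTwoCoeff u w : ℂ)‖ ^ 2
      ≤ ∑ w ∈ lowPolys F (n - k), ((monicDivisors w).card : ℝ) ^ 2 := by
        refine Finset.sum_le_sum fun w _ => ?_
        gcongr
        rw [Complex.norm_intCast]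
        exact_mod_cast abs_typeTwoCoeff_le u w
    _ ≤ (((n - k : ℕ) : ℝ) + 1) ^ 3 * (Fintype.card F : ℝ) ^ (n - k) := by
        exact_mod_cast sum_lowPolys_card_monicDivisors_sq_le (n - k)
    _ ≤ _ := by
        gcongr
        exact_mod_cast (by omega : n - k + 1 ≤ n)

/-- Either some type I sum or some type II sum is large, given that the error terms in Vaughan's
identity are small. -/
lemma exists_typeSum_large {n u : ℕ} (hu0 : 0 < u) (hu : 2 * u < n)
    (hq : 3 ≤ Fintype.card F) (Φ : F[X] → ℂ) (hΦ : ∀ f, ‖Φ f‖ ≤ 1) {D : ℝ}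
    (hD : 4 * (Fintype.card F : ℝ) ^ (4 * u + 1) ≤ D)
    (hcorr : D ≤ ‖∑ f ∈ lowPolys F n, (polyMu f : ℂ) * Φ f‖) :
    ∃ k < n, D / (4 * n) ≤ ‖typeOneSum n u Φ k‖ ∨ D / (4 * n) ≤ ‖typeTwoSum n u Φ k‖ := by
  have hn0 : (0 : ℝ) < n := by exact_mod_cast (by omega : 0 < n)
  by_contra! hcon
  have hpig : ∀ T : ℕ → ℂ, (∀ k < n, ‖T k‖ < D / (4 * n)) →
      ‖∑ k ∈ Finset.range n, T k‖ ≤ D / 4 := by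
    intro T hT
    calc _ ≤ ∑ k ∈ Finset.range n, D / (4 * n) :=
          (norm_sum_le _ _).trans
            (Finset.sum_le_sum fun k hk => (hT k (Finset.mem_range.1 hk)).le)
      _ = _ := by
          rw [Finset.sum_const, Finset.card_range, nsmul_eq_mul]
          field_simp
  have h1 := hpig (typeOneSum n u Φ) fun k hk => (hcon k hk).1
  have h2 := hpig (typeTwoSum n u Φ) fun k hk => (hcon k hk).2
  have h3 := norm_sum_polyMuLow_mul_le n u Φ hΦ
  have h4 := norm_sum_typeOneCoeff_le hq hu
  have hq' : (3 : ℝ) ≤ Fintype.card F := by exact_mod_cast hq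
  have h5 : (Fintype.card F : ℝ) ^ (u + 1) ≤ (Fintype.card F : ℝ) ^ (4 * u) :=
    pow_le_pow_right₀ (by linarith) (by omega)
  have h6 : 3 * (Fintype.card F : ℝ) ^ (4 * u) ≤ (Fintype.card F : ℝ) ^ (4 * u + 1) := by
    rw [pow_succ']
    gcongr
  have hpos : (0 : ℝ) < (Fintype.card F : ℝ) ^ (4 * u) := by positivity
  rw [sum_polyMu_mul_eq hu] at hcorr
  have h7 := (norm_add_le_of_le (norm_sub_le_of_le (norm_add_le_of_le
    (le_of_eq_of_le (norm_mul _ _) (mul_le_mul (le_of_eq (Complex.norm_ofNat 2)) h3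
      (norm_nonneg _) (by norm_num))) h2) h1)
    (le_of_eq_of_le (norm_mul _ _) (mul_le_mul h4 (hΦ 0) (norm_nonneg _) hpos.le)))
  have h8 := hcorr.trans h7
  linarith

end Decomposition

section Conclusion

variable {F : Type*} [Field F] [Fintype F]

lemma three_le_card_of_ringChar_ne_two (hchar : ringChar F ≠ 2) : 3 ≤ Fintype.card F := by
  have h1 := FiniteField.odd_card_of_char_ne_two hchar
  have h2 := Fintype.one_lt_card (α := F)
  omega

/-- The diagonal terms bound the type II average of a unimodular function from below. -/
lemma inv_card_pow_le_typeTwo_average (Φ : F[X] → ℂ) (hΦ : ∀ f, ‖Φ f‖ = 1) (k m : ℕ) :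
    1 / (Fintype.card F : ℝ) ^ m ≤ (1 / (Fintype.card F : ℝ) ^ (2 * m)) *
      ∑ y : Fin m → F, ∑ y' : Fin m → F, ‖(1 / (Fintype.card F : ℂ) ^ k) *
        ∑ x : Fin k → F, Φ (monicPoly F k x * lowPoly F m y) *
          (starRingEnd ℂ) (Φ (monicPoly F k x * lowPoly F m y'))‖ ^ 2 := by
  have hq : (Fintype.card F : ℂ) ≠ 0 := by exact_mod_cast Fintype.card_ne_zero
  have hq' : (0 : ℝ) < Fintype.card F := by exact_mod_cast Fintype.card_pos
  have hdiag : ∀ y : Fin m → F, ‖(1 / (Fintype.card F : ℂ) ^ k) *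
      ∑ x : Fin k → F, Φ (monicPoly F k x * lowPoly F m y) *
        (starRingEnd ℂ) (Φ (monicPoly F k x * lowPoly F m y))‖ ^ 2 = 1 := by
    intro y
    simp only [Complex.mul_conj', hΦ]
    simp [hq]
  have hsum : (Fintype.card F : ℝ) ^ m ≤
      ∑ y : Fin m → F, ∑ y' : Fin m → F, ‖(1 / (Fintype.card F : ℂ) ^ k) *
        ∑ x : Fin k → F, Φ (monicPoly F k x * lowPoly F m y) *
          (starRingEnd ℂ) (Φ (monicPoly F k x * lowPoly F m y'))‖ ^ 2 := by
    calc (Fintype.card F : ℝ) ^ m = ∑ _y : Fin m → F, (1 : ℝ) := by simp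
      _ ≤ _ := by
        refine Finset.sum_le_sum fun y _ => ?_
        rw [← hdiag y]
        exact Finset.single_le_sum (f := fun y' => ‖(1 / (Fintype.card F : ℂ) ^ k) *
          ∑ x : Fin k → F, Φ (monicPoly F k x * lowPoly F m y) *
            (starRingEnd ℂ) (Φ (monicPoly F k x * lowPoly F m y'))‖ ^ 2)
          (fun _ _ => by positivity) (Finset.mem_univ y)
  calc 1 / (Fintype.card F : ℝ) ^ m
      = (1 / (Fintype.card F : ℝ) ^ (2 * m)) * (Fintype.card F : ℝ) ^ m := by
        rw [two_mul, pow_add]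
        field_simp
    _ ≤ _ := by gcongr

lemma typeOne_average_large {n k u : ℕ} {δ : ℝ} (hδ0 : 0 < δ) (hk : k < n) (Φ : F[X] → ℂ)
    (h : δ * (Fintype.card F : ℝ) ^ n / (4 * n) ≤ ‖typeOneSum n u Φ k‖) :
    δ ^ 2 / (16 * (n : ℝ) ^ 5) ≤ (1 / (Fintype.card F : ℝ) ^ k) * ∑ x : Fin k → F,
      ‖(1 / (Fintype.card F : ℂ) ^ (n - k)) *
        ∑ y : Fin (n - k) → F, Φ (monicPoly F k x * lowPoly F (n - k) y)‖ ^ 2 := by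
  have hn0 : (0 : ℝ) < n := by exact_mod_cast (by omega : 0 < n)
  have hq0 : (0 : ℝ) < Fintype.card F := by exact_mod_cast Fintype.card_pos
  have hbound := (pow_le_pow_left₀ (by positivity) h 2).trans (norm_typeOneSum_sq_le hk u Φ)
  simp only [sum_monicPolys, sum_lowPolys] at hbound
  simp only [norm_mul, mul_pow, ← Finset.mul_sum, norm_div, norm_one, norm_pow, norm_natCast]
  set S := ∑ x : Fin k → F,
    ‖∑ y : Fin (n - k) → F, Φ (monicPoly F k x * lowPoly F (n - k) y)‖ ^ 2
  have hab : (Fintype.card F : ℝ) ^ n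
      = (Fintype.card F : ℝ) ^ k * (Fintype.card F : ℝ) ^ (n - k) := by
    rw [← pow_add, Nat.add_sub_cancel' hk.le]
  rw [hab] at hbound
  set a := (Fintype.card F : ℝ) ^ k with ha
  set b := (Fintype.card F : ℝ) ^ (n - k) with hb
  have ha0 : 0 < a := by positivity
  have hb0 : 0 < b := by positivity
  have hS : δ ^ 2 * a * b ^ 2 ≤ 16 * n ^ 5 * S := by
    refine le_of_mul_le_mul_left ?_ ha0
    rw [div_pow, div_le_iff₀ (by positivity)] at hbound
    linarith
  rw [div_le_iff₀ (by positivity)]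
  calc δ ^ 2 = δ ^ 2 * a * b ^ 2 / (a * b ^ 2) := by field_simp
    _ ≤ 16 * n ^ 5 * S / (a * b ^ 2) := by gcongr
    _ = _ := by field_simp

lemma typeTwo_average_large {n k u : ℕ} {δ : ℝ} (hδ0 : 0 < δ) (hk0 : 0 < k) (hk : k < n)
    (Φ : F[X] → ℂ)
    (h : δ * (Fintype.card F : ℝ) ^ n / (4 * n) ≤ ‖typeTwoSum n u Φ k‖) :
    δ ^ 4 / (256 * (n : ℝ) ^ 10) ≤ (1 / (Fintype.card F : ℝ) ^ (2 * (n - k))) *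
      ∑ y : Fin (n - k) → F, ∑ y' : Fin (n - k) → F, ‖(1 / (Fintype.card F : ℂ) ^ k) *
        ∑ x : Fin k → F, Φ (monicPoly F k x * lowPoly F (n - k) y) *
          (starRingEnd ℂ) (Φ (monicPoly F k x * lowPoly F (n - k) y'))‖ ^ 2 := by
  have hn0 : (0 : ℝ) < n := by exact_mod_cast (by omega : 0 < n)
  have hq0 : (0 : ℝ) < Fintype.card F := by exact_mod_cast Fintype.card_pos
  have hbound := (pow_le_pow_left₀ (by positivity) h 4).trans
    (norm_typeTwoSum_pow_four_le hk0 hk u Φ)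
  simp only [sum_monicPolys, sum_lowPolys] at hbound
  simp only [norm_mul _ (Finset.sum _ _), mul_pow, ← Finset.mul_sum, norm_div, norm_one,
    norm_pow, norm_natCast]
  set S := ∑ y : Fin (n - k) → F, ∑ y' : Fin (n - k) → F,
    ‖∑ x : Fin k → F, Φ (monicPoly F k x * lowPoly F (n - k) y) *
      (starRingEnd ℂ) (Φ (monicPoly F k x * lowPoly F (n - k) y'))‖ ^ 2
  rw [mul_comm 2 (n - k), pow_mul]
  have hab : (Fintype.card F : ℝ) ^ n
      = (Fintype.card F : ℝ) ^ k * (Fintype.card F : ℝ) ^ (n - k) := by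
    rw [← pow_add, Nat.add_sub_cancel' hk.le]
  rw [hab] at hbound
  set a := (Fintype.card F : ℝ) ^ k with ha
  set b := (Fintype.card F : ℝ) ^ (n - k) with hb
  have ha0 : 0 < a := by positivity
  have hb0 : 0 < b := by positivity
  have hS : δ ^ 4 * (a ^ 2 * b ^ 2) ≤ 256 * n ^ 10 * S := by
    refine le_of_mul_le_mul_left ?_ (show 0 < a ^ 2 * b ^ 2 by positivity)
    rw [div_pow, div_le_iff₀ (by positivity)] at hbound
    linarith
  rw [div_le_iff₀ (by positivity)]
  calc δ ^ 4 = δ ^ 4 * (a ^ 2 * b ^ 2) / (a ^ 2 * b ^ 2) := by field_simp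
    _ ≤ 256 * n ^ 10 * S / (a ^ 2 * b ^ 2) := by gcongr
    _ = _ := by field_simp

/-- If `δ` is tiny then it is dominated by the diagonal of the type II average. -/
lemma pow_four_div_le_of_small {Q δ : ℝ} {n u : ℕ} (hQ : 1 ≤ Q) (hn : 1 ≤ n)
    (hun : 5 * u + 2 ≤ n) (hδ0 : 0 < δ) (hδ1 : δ ≤ 1)
    (h : δ * Q ^ n < 4 * Q ^ (4 * u + 1)) :
    δ ^ 4 / (256 * (n : ℝ) ^ 10) ≤ 1 / Q ^ (u + 1) := by
  have hQ0 : 0 < Q := by linarith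
  have h1 : δ ^ 4 ≤ δ := pow_le_of_le_one hδ0.le hδ1 (by norm_num)
  have hn1 : (1 : ℝ) ≤ (n : ℝ) ^ 10 := one_le_pow₀ (by exact_mod_cast hn)
  have h2 : δ * Q ^ (u + 1) < 4 := by
    have h3 : Q ^ (4 * u + 1) * Q ^ (u + 1) ≤ Q ^ n := by
      rw [← pow_add]
      exact pow_le_pow_right₀ hQ (by omega)
    have h4 : Q ^ (4 * u + 1) * (δ * Q ^ (u + 1)) < Q ^ (4 * u + 1) * 4 := by
      calc _ = δ * (Q ^ (4 * u + 1) * Q ^ (u + 1)) := by ring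
        _ ≤ δ * Q ^ n := by gcongr
        _ < _ := by linarith
    exact lt_of_mul_lt_mul_left h4 (by positivity)
  rw [div_le_div_iff₀ (by positivity) (by positivity)]
  calc δ ^ 4 * Q ^ (u + 1) ≤ δ * Q ^ (u + 1) := by gcongr
    _ ≤ 1 * (256 * (n : ℝ) ^ 10) := by linarith

end Conclusion

/-- Vaughan dichotomy for quadratic phases: if `μ` correlates with the quadratic phase
`Φ(f) = χ(P(x(f)))` at level `δ qⁿ`, then either a type I average is large for some
`k ≤ n/9`, or a type II average is large for some `k ∈ [n/18, 17n/18]`. -/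
theorem vaughan_dichotomy {F : Type*} [Field F] [Fintype F] (hchar : ringChar F ≠ 2)
    (q : ℕ) (hq : Fintype.card F = q) (n : ℕ) (hn : 18 ≤ n)
    (δ : ℝ) (hδ0 : 0 < δ) (hδ1 : δ ≤ 1)
    (P : MvPolynomial (Fin n) F) (hP : P.totalDegree ≤ 2)
    (χ : AddChar F Circle) (hχ : χ ≠ 1)
    (Phi : Polynomial F → ℂ)
    (hPhi : ∀ f : Polynomial F,
      Phi f = (χ (MvPolynomial.eval (fun i : Fin n => f.coeff (i : ℕ)) P) : ℂ))
    (hcorr : δ * (q : ℝ) ^ n ≤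
      ‖∑ x : Fin n → F, (polyMu (lowPoly F n x) : ℂ) * Phi (lowPoly F n x)‖) :
    (∃ k : ℕ, 9 * k ≤ n ∧
      δ ^ 2 / (16 * (n : ℝ) ^ 5) ≤
        (1 / (q : ℝ) ^ k) * ∑ x : Fin k → F,
          ‖(1 / (q : ℂ) ^ (n - k)) *
            ∑ y : Fin (n - k) → F, Phi (monicPoly F k x * lowPoly F (n - k) y)‖ ^ 2) ∨
    (∃ k : ℕ, n ≤ 18 * k ∧ 18 * k ≤ 17 * n ∧
      δ ^ 4 / (256 * (n : ℝ) ^ 10) ≤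
        (1 / (q : ℝ) ^ (2 * (n - k))) *
          ∑ y : Fin (n - k) → F, ∑ y' : Fin (n - k) → F,
            ‖(1 / (q : ℂ) ^ k) *
              ∑ x : Fin k → F,
                Phi (monicPoly F k x * lowPoly F (n - k) y) *
                  (starRingEnd ℂ) (Phi (monicPoly F k x * lowPoly F (n - k) y'))‖ ^ 2) := by
  subst hq
  have hnorm : ∀ f, ‖Phi f‖ = 1 := fun f => by rw [hPhi, Circle.norm_coe]
  obtain ⟨u, hu0, hu1, hu2⟩ : ∃ u : ℕ, 0 < u ∧ 18 * u ≤ n ∧ n < 18 * (u + 1) :=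
    ⟨n / 18, by omega, by omega, by omega⟩
  have hq3 := three_le_card_of_ringChar_ne_two hchar
  rw [← sum_lowPolys n fun f => (polyMu f : ℂ) * Phi f] at hcorr
  rcases lt_or_ge (δ * (Fintype.card F : ℝ) ^ n) (4 * (Fintype.card F : ℝ) ^ (4 * u + 1))
    with hsmall | hlarge
  · refine Or.inr ⟨n - (u + 1), by omega, by omega, ?_⟩
    refine le_trans ?_ (inv_card_pow_le_typeTwo_average Phi hnorm _ _)
    rw [Nat.sub_sub_self (by omega)]
    exact pow_four_div_le_of_small (by exact_mod_cast (by omega : 1 ≤ Fintype.card F))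
      (by omega) (by omega) hδ0 hδ1 hsmall
  · have hpos : 0 < δ * (Fintype.card F : ℝ) ^ n / (4 * n) := by
      have : (0 : ℝ) < n := by exact_mod_cast (by omega : 0 < n)
      have : (0 : ℝ) < Fintype.card F := by exact_mod_cast Fintype.card_pos
      positivity
    obtain ⟨k, hk, h | h⟩ := exists_typeSum_large hu0 (by omega) hq3 Phi
      (fun f => (hnorm f).le) hlarge hcorr
    · have hne : typeOneSum n u Phi k ≠ 0 := norm_pos_iff.1 (hpos.trans_le h)
      have hk2 : k ≤ 2 * u := le_of_not_gt fun hlt => hne (typeOneSum_eq_zero Phi hlt)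
      exact Or.inl ⟨k, by omega, typeOne_average_large hδ0 hk Phi h⟩
    · have hne : typeTwoSum n u Phi k ≠ 0 := norm_pos_iff.1 (hpos.trans_le h)
      have hk1 : u < k := lt_of_not_ge fun hle => hne (typeTwoSum_eq_zero_of_le Phi hle)
      have hk2 : u + 1 < n - k :=
        lt_of_not_ge fun hle => hne (typeTwoSum_eq_zero_of_sub_le Phi hle)
      exact Or.inr ⟨k, by omega, by omega,
        typeTwo_average_large hδ0 (by omega) hk Phi h⟩
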